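/- Let d ≥ 1 and suppose E : ℤ^d → ℝ is ℤ^d-symmetric, satisfies Σ_{x∈ℤ^d} E(x) = 0 and Σ_{x∈ℤ^d}|x|²E(x) = 0, and satisfies |E(x)| ≤ K⟨x⟩^{−(d+2+ρ)} for some K, ρ > 0. Choose σ ∈ (0,ρ) with σ ≤ 2 and let α be a multi-index with |α| < 2 + σ. Then there is a constant c = c(σ,ρ,d) such that the classical derivative of Ê satisfies |Ê_α(k)| ≤ cK|k|^{2+σ−|α|} for all k ∈ 𝕋^d. -/

import Mathlib

open MeasureTheory Filter

noncomputable section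

namespace SO

variable {d : ℕ}

/-- Euclidean norm of a lattice point. -/
def znorm (x : Fin d → ℤ) : ℝ := Real.sqrt (∑ i, ((x i : ℝ)) ^ 2)

/-- Euclidean norm of a point of ℝ^d. -/
def rnorm (k : Fin d → ℝ) : ℝ := Real.sqrt (∑ i, (k i) ^ 2)

/-- `⟨x⟩ = max{|x|, 1}`. -/
def nn (x : Fin d → ℤ) : ℝ := max (znorm x) 1

/-- Kronecker delta at the origin. -/
def kdelta (x : Fin d → ℤ) : ℝ := if x = 0 then 1 else 0

/-- Discrete convolution on ℤ^d. -/
def conv (f g : (Fin d → ℤ) → ℝ) (x : Fin d → ℤ) : ℝ := ∑' y, f (x - y) * g y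

/-- n-fold convolution power. -/
def convpow (f : (Fin d → ℤ) → ℝ) : ℕ → (Fin d → ℤ) → ℝ
  | 0 => kdelta
  | n + 1 => conv f (convpow f n)

/-- ℤ^d-symmetry of a function on ℤ^d : invariance under permutations of the
coordinates and reflections in coordinate hyperplanes. -/
def ZdSymm (f : (Fin d → ℤ) → ℝ) : Prop :=
  ∀ (σ : Equiv.Perm (Fin d)) (e : Fin d → ℤ), (∀ i, e i = 1 ∨ e i = -1) →
    ∀ x, f (fun i => e i * x (σ i)) = f x

/-- ℤ^d-symmetry of a function on ℝ^d. -/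
def RdSymm (v : (Fin d → ℝ) → ℝ) : Prop :=
  ∀ (σ : Equiv.Perm (Fin d)) (e : Fin d → ℝ), (∀ i, e i = 1 ∨ e i = -1) →
    ∀ x, v (fun i => e i * x (σ i)) = v x

/-- Partial derivative in coordinate direction `i`. -/
def pd {E : Type*} [NormedAddCommGroup E] [NormedSpace ℝ E] (i : Fin d)
    (f : (Fin d → ℝ) → E) : (Fin d → ℝ) → E :=
  fun x => fderiv ℝ f x (Pi.single i 1)

/-- Multi-index partial derivative `∇^α`. -/
def mderiv {E : Type*} [NormedAddCommGroup E] [NormedSpace ℝ E] (α : Fin d → ℕ)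
    (f : (Fin d → ℝ) → E) : (Fin d → ℝ) → E :=
  ((List.finRange d).flatMap fun i => List.replicate (α i) i).foldr (fun i g => pd i g) f

/-- Degree `|α|` of a multi-index. -/
def deg (α : Fin d → ℕ) : ℕ := ∑ i, α i

/-- The torus `(−π, π]^d`. -/
def Td (d : ℕ) : Set (Fin d → ℝ) := Set.univ.pi fun _ => Set.Ioc (-Real.pi) Real.pi

/-- Fourier transform of a (summable) function on ℤ^d. -/
def ft (h : (Fin d → ℤ) → ℝ) (k : Fin d → ℝ) : ℂ :=
  ∑' x : Fin d → ℤ, (h x : ℂ) * Complex.exp (Complex.I * ((∑ i, k i * (x i : ℝ) : ℝ) : ℂ))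

/-- Normalized `L^p` norm on the torus. -/
def lpT (p : ℝ) (g : (Fin d → ℝ) → ℂ) : ℝ :=
  ((1 / (2 * Real.pi) ^ d) * ∫ k in Td d, ‖g k‖ ^ p) ^ (1 / p)

/-- Smooth `2π`-periodic test function. -/
def PeriodicSmooth (φ : (Fin d → ℝ) → ℂ) : Prop :=
  ContDiff ℝ (⊤ : ℕ∞) φ ∧ ∀ (x : Fin d → ℝ) (i : Fin d), φ (x + Pi.single i (2 * Real.pi)) = φ x

/-- `g` has `α`-th weak derivative `gα` on the torus, in the sense of the
integration-by-parts identity against smooth periodic test functions. -/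
def HasWeakDeriv (α : Fin d → ℕ) (g gα : (Fin d → ℝ) → ℂ) : Prop :=
  ∀ φ : (Fin d → ℝ) → ℂ, PeriodicSmooth φ →
    ∫ k in Td d, g k * mderiv α φ k = (-1 : ℂ) ^ deg α * ∫ k in Td d, gα k * φ k

/-- The hypotheses on the spread-out kernel `v`: nonnegative, bounded,
ℤ^d-symmetric, supported in `[-1,1]^d`, with piecewise continuous mixed
derivative `∂^d v/∂x_1⋯∂x_d`, and total integral 1. -/
structure GoodKernel (d : ℕ) (v : (Fin d → ℝ) → ℝ) : Prop where
  nonneg : ∀ x, 0 ≤ v x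
  bounded : ∃ M, ∀ x, v x ≤ M
  symm : RdSymm v
  supp : ∀ x, v x ≠ 0 → ∀ i, |x i| ≤ 1
  piecewiseCont : ∃ S : Set (Fin d → ℝ), IsClosed S ∧ volume S = 0 ∧
    ContinuousOn (mderiv (fun _ => (1 : ℕ)) v) Sᶜ
  integral_one : ∫ x, v x = 1

/-- Normalization sum for the step distribution. -/
def sumv (v : (Fin d → ℝ) → ℝ) (L : ℝ) : ℝ := ∑' y : Fin d → ℤ, v fun i => (y i : ℝ) / L

/-- Spread-out step distribution `D`. -/
def DSO (v : (Fin d → ℝ) → ℝ) (L : ℝ) (x : Fin d → ℤ) : ℝ :=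
  v (fun i => (x i : ℝ) / L) / sumv v L

/-- Variance `σ²` of `D`. -/
def sigSq (v : (Fin d → ℝ) → ℝ) (L : ℝ) : ℝ := ∑' x : Fin d → ℤ, znorm x ^ 2 * DSO v L x

/-- Nearest-neighbour step distribution. -/
def Dnn (x : Fin d → ℤ) : ℝ := if (∑ i, (x i) ^ 2) = 1 then 1 / (2 * (d : ℝ)) else 0

/-- Fourier integral `x ↦ ∫_{𝕋^d} e^{−ik·x}/F̂(k) dk/(2π)^d`. -/
def fint (F : (Fin d → ℤ) → ℝ) (x : Fin d → ℤ) : ℝ :=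
  (1 / (2 * Real.pi) ^ d) *
    (∫ k in Td d,
      Complex.exp (-Complex.I * ((∑ i, k i * (x i : ℝ) : ℝ) : ℂ)) / ft F k).re

/-- Spread-out Green function `S_μ`. -/
def SGreen (v : (Fin d → ℝ) → ℝ) (L : ℝ) (μ : ℝ) (x : Fin d → ℤ) : ℝ :=
  fint (fun y => kdelta y - μ * DSO v L y) x

/-- Nearest-neighbour Green function `C_μ`. -/
def CGreen (μ : ℝ) (x : Fin d → ℤ) : ℝ :=
  fint (fun y => kdelta y - μ * Dnn y) x

/-- The constant `a_d = dΓ((d−2)/2)/(2π^{d/2})`. -/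
def aGauss (d : ℕ) : ℝ := d * Real.Gamma (((d : ℝ) - 2) / 2) / (2 * Real.pi ^ ((d : ℝ) / 2))

end SO

namespace SO

variable {d : ℕ}

lemma one_le_nn (x : Fin d → ℤ) : 1 ≤ nn x := le_max_right _ _

lemma nn_pos (x : Fin d → ℤ) : 0 < nn x := one_pos.trans_le (one_le_nn x)

lemma abs_coord_le_nn (x : Fin d → ℤ) (i : Fin d) : |(x i : ℝ)| ≤ nn x := by
  refine le_max_of_le_left (Real.abs_le_sqrt ?_)
  exact Finset.single_le_sum (f := fun i => (x i : ℝ) ^ 2) (fun _ _ => sq_nonneg _)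
    (Finset.mem_univ i)

lemma abs_sum_mul_le (k : Fin d → ℝ) (x : Fin d → ℤ) :
    |∑ i, k i * (x i : ℝ)| ≤ rnorm k * nn x := by
  refine le_trans ?_ (mul_le_mul_of_nonneg_left (le_max_left _ _) (Real.sqrt_nonneg _))
  rw [rnorm, znorm, ← Real.sqrt_mul (Finset.sum_nonneg fun _ _ => sq_nonneg _)]
  exact Real.abs_le_sqrt (Finset.sum_mul_sq_le_sq_mul_sq _ _ _)

/-- The lattice `ℤ^d` sums `⟨x⟩^r` for `r < -d`. -/
lemma summable_nn_rpow {r : ℝ} (hr : r < -(d : ℝ)) :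
    Summable fun x : Fin d → ℤ => nn x ^ r := by
  classical
  let b := Pi.basisFun ℝ (Fin d)
  let L := Submodule.span ℤ (Set.range b)
  have hrank : Module.finrank ℤ L = d := by
    rw [ZLattice.rank ℝ L]
    simp
  have hsum : Summable fun z : L => ‖z‖ ^ r :=
    ZLattice.summable_norm_rpow L r (by rwa [hrank])
  let φ : (Fin d → ℤ) → L := fun x => ⟨fun i => (x i : ℝ), by
    have : (fun i => (x i : ℝ)) = ∑ i, x i • b i := by
      ext j
      simp [b, Pi.single_apply]
    rw [this]
    exact Submodule.sum_mem _ fun i _ =>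
      Submodule.smul_mem _ _ (Submodule.subset_span (Set.mem_range_self i))⟩
  have hφ : Function.Injective φ := fun x y h => by
    ext i
    have hi : (x i : ℝ) = y i := congrFun (congrArg Subtype.val h) i
    exact_mod_cast hi
  refine Summable.of_norm_bounded_eventually (hsum.comp_injective hφ) ?_
  filter_upwards [(Set.finite_singleton (0 : Fin d → ℤ)).compl_mem_cofinite] with x hx
  have hx0 : 0 < ‖φ x‖ := by
    rw [norm_pos_iff]
    intro h
    apply hx
    apply hφ
    rw [h]
    ext i
    simp [φ]
  rw [Real.norm_of_nonneg (Real.rpow_nonneg (nn_pos x).le _)]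
  refine Real.rpow_le_rpow_of_nonpos hx0 ?_ (hr.le.trans (by simp))
  change ‖fun i => (x i : ℝ)‖ ≤ nn x
  exact (pi_norm_le_iff_of_nonneg (nn_pos x).le).2 fun i => abs_coord_le_nn x i

/-- The monomial `x ↦ ∏_{i ∈ l} x_i` indexed by a list of coordinates. -/
def monomialList (l : List (Fin d)) (x : Fin d → ℤ) : ℝ := (l.map fun i => (x i : ℝ)).prod

@[simp]
lemma monomialList_nil (x : Fin d → ℤ) : monomialList [] x = 1 := by simp [monomialList]

@[simp]
lemma monomialList_cons (i : Fin d) (l : List (Fin d)) (x : Fin d → ℤ) :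
    monomialList (i :: l) x = x i * monomialList l x := by simp [monomialList]

lemma abs_monomialList_le (l : List (Fin d)) (x : Fin d → ℤ) :
    |monomialList l x| ≤ nn x ^ l.length := by
  induction l with
  | nil => simp
  | cons i l ih =>
    rw [monomialList_cons, abs_mul, List.length_cons, pow_succ']
    exact mul_le_mul (abs_coord_le_nn x i) ih (abs_nonneg _) (nn_pos x).le

/-- Termwise differentiation of an absolutely convergent Fourier series. -/
lemma pd_tsum (a : (Fin d → ℤ) → ℂ) (ha : Summable fun x => ‖a x‖ * nn x) (i : Fin d) :
    pd i (fun k : Fin d → ℝ => ∑' x : Fin d → ℤ,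
        a x * Complex.exp (Complex.I * ((∑ i, k i * (x i : ℝ) : ℝ) : ℂ))) =
      fun k => ∑' x : Fin d → ℤ, a x * (Complex.I * (x i : ℝ)) *
        Complex.exp (Complex.I * ((∑ i, k i * (x i : ℝ) : ℝ) : ℂ)) := by
  let ℓ : (Fin d → ℤ) → ((Fin d → ℝ) →L[ℝ] ℝ) := fun x =>
    ∑ i, (x i : ℝ) • ContinuousLinearMap.proj (R := ℝ) (φ := fun _ : Fin d => ℝ) i
  have hℓ (x : Fin d → ℤ) (k : Fin d → ℝ) : ℓ x k = ∑ i, k i * (x i : ℝ) := by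
    simp [ℓ, mul_comm]
  have hℓn (x : Fin d → ℤ) : ‖ℓ x‖ ≤ d * nn x := by
    refine ContinuousLinearMap.opNorm_le_bound _
      (mul_nonneg (Nat.cast_nonneg _) (nn_pos x).le) fun k => ?_
    rw [hℓ]
    refine (norm_sum_le _ _).trans ?_
    refine (Finset.sum_le_card_nsmul _ _ (nn x * ‖k‖) fun i _ => ?_).trans ?_
    · rw [norm_mul, mul_comm]
      exact mul_le_mul (abs_coord_le_nn x i) (norm_le_pi_norm k i) (norm_nonneg _) (nn_pos x).le
    · simp [mul_assoc]
  let f' : (Fin d → ℤ) → (Fin d → ℝ) → ((Fin d → ℝ) →L[ℝ] ℂ) := fun x k =>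
    a x • (Complex.exp (Complex.I * ((∑ i, k i * (x i : ℝ) : ℝ) : ℂ)) •
      (Complex.I • (Complex.ofRealCLM.comp (ℓ x))))
  have hexp (x : Fin d → ℤ) (k : Fin d → ℝ) :
      ‖Complex.exp (Complex.I * ((∑ i, k i * (x i : ℝ) : ℝ) : ℂ))‖ = 1 := by
    rw [mul_comm, Complex.norm_exp_ofReal_mul_I]
  have hd (x : Fin d → ℤ) (k : Fin d → ℝ) : HasFDerivAt (fun k : Fin d → ℝ =>
      a x * Complex.exp (Complex.I * ((∑ i, k i * (x i : ℝ) : ℝ) : ℂ))) (f' x k) k := by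
    have h1 : HasFDerivAt (fun k : Fin d → ℝ => ((∑ i, k i * (x i : ℝ) : ℝ) : ℂ))
        (Complex.ofRealCLM.comp (ℓ x)) k := by
      convert (Complex.ofRealCLM.comp (ℓ x)).hasFDerivAt (x := k) using 2 with k
      simp [hℓ]
    exact ((h1.const_mul Complex.I).cexp).const_mul (a x)
  have hb (x : Fin d → ℤ) (k : Fin d → ℝ) : ‖f' x k‖ ≤ d * (‖a x‖ * nn x) := by
    have h2 : ‖Complex.ofRealCLM.comp (ℓ x)‖ ≤ d * nn x := by
      refine (ContinuousLinearMap.opNorm_comp_le _ _).trans ?_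
      rw [Complex.ofRealCLM_norm, one_mul]
      exact hℓn x
    calc ‖f' x k‖ = ‖a x‖ * ‖Complex.ofRealCLM.comp (ℓ x)‖ := by
          simp only [f', norm_smul, hexp, Complex.norm_I, one_mul]
      _ ≤ ‖a x‖ * (d * nn x) := mul_le_mul_of_nonneg_left h2 (norm_nonneg _)
      _ = _ := by ring
  have hs0 : Summable fun x : Fin d → ℤ =>
      a x * Complex.exp (Complex.I * ((∑ i, (0 : Fin d → ℝ) i * (x i : ℝ) : ℝ) : ℂ)) := by
    refine Summable.of_norm_bounded ha fun x => ?_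
    rw [norm_mul, hexp]
    exact mul_le_mul_of_nonneg_left (one_le_nn x) (norm_nonneg _)
  funext k
  have hu : Summable fun x => d * (‖a x‖ * nn x) := ha.mul_left _
  have hsf : Summable fun x => f' x k := Summable.of_norm_bounded hu fun x => hb x k
  rw [pd, (hasFDerivAt_tsum hu hd hb hs0 k).fderiv]
  refine ((ContinuousLinearMap.apply ℝ ℂ (Pi.single i (1 : ℝ))).map_tsum hsf).trans
    (tsum_congr fun x => ?_)
  rw [ContinuousLinearMap.apply_apply]
  simp only [f', smul_apply, ContinuousLinearMap.comp_apply, hℓ,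
    Complex.ofRealCLM_apply, smul_eq_mul]
  have : ∑ j, (Pi.single i (1 : ℝ) : Fin d → ℝ) j * (x j : ℝ) = x i := by
    simp [Pi.single_apply]
  rw [this]
  ring

lemma summable_mul_monomialList {E : (Fin d → ℤ) → ℝ} {N : ℕ}
    (hS : Summable fun x => |E x| * nn x ^ N) (l : List (Fin d)) (hl : l.length ≤ N) :
    Summable fun x => E x * monomialList l x := by
  refine Summable.of_norm_bounded hS fun x => ?_
  rw [Real.norm_eq_abs, abs_mul]
  exact mul_le_mul_of_nonneg_left ((abs_monomialList_le l x).trans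
    (pow_le_pow_right₀ (one_le_nn x) hl)) (abs_nonneg _)

lemma foldr_pd_ft {E : (Fin d → ℤ) → ℝ} {N : ℕ}
    (hS : Summable fun x => |E x| * nn x ^ N) (l : List (Fin d)) (hl : l.length ≤ N) :
    l.foldr (fun i g => pd i g) (ft E) = fun k => ∑' x : Fin d → ℤ,
      ((E x * monomialList l x : ℝ) * Complex.I ^ l.length : ℂ) *
        Complex.exp (Complex.I * ((∑ i, k i * (x i : ℝ) : ℝ) : ℂ)) := by
  induction l with
  | nil =>
    funext k
    simp [ft]
  | cons i l ih =>
    have hl' : l.length + 1 ≤ N := hl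
    rw [List.foldr_cons, ih (by lia), pd_tsum]
    · funext k
      refine tsum_congr fun x => ?_
      rw [monomialList_cons, List.length_cons, pow_succ]
      push_cast
      ring
    · refine Summable.of_norm_bounded hS fun x => ?_
      simp only [norm_mul, norm_pow, Complex.norm_I, one_pow, mul_one, Complex.norm_real,
        Real.norm_eq_abs, abs_abs, abs_of_pos (nn_pos x), mul_assoc]
      refine mul_le_mul_of_nonneg_left ?_ (abs_nonneg _)
      calc |monomialList l x| * nn x ≤ nn x ^ l.length * nn x :=
            mul_le_mul_of_nonneg_right (abs_monomialList_le l x) (nn_pos x).le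
        _ = nn x ^ (l.length + 1) := (pow_succ _ _).symm
        _ ≤ nn x ^ N := pow_le_pow_right₀ (one_le_nn x) hl'

lemma length_flatMap_replicate (α : Fin d → ℕ) :
    ((List.finRange d).flatMap fun i => List.replicate (α i) i).length = deg α := by
  simp [List.length_flatMap, deg, Fin.sum_univ_def]

/-- The signed coordinate permutation of `ℤ^d` as a bijection. -/
def signedPerm (τ : Equiv.Perm (Fin d)) (e : Fin d → ℤ) (he : ∀ i, e i = 1 ∨ e i = -1) :
    (Fin d → ℤ) ≃ (Fin d → ℤ) where
  toFun x i := e i * x (τ i)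
  invFun x i := e (τ.symm i) * x (τ.symm i)
  left_inv x := by
    funext i
    rcases he (τ.symm i) with h | h <;> simp [h]
  right_inv x := by
    funext i
    rcases he i with h | h <;> simp [h]

lemma tsum_comp_signedPerm {E : (Fin d → ℤ) → ℝ} (hE : ZdSymm E) (τ : Equiv.Perm (Fin d))
    (e : Fin d → ℤ) (he : ∀ i, e i = 1 ∨ e i = -1) (f : (Fin d → ℤ) → ℝ) :
    ∑' x, E x * f x = ∑' x, E x * f (fun i => e i * x (τ i)) := by
  rw [← (signedPerm τ e he).tsum_eq (fun x => E x * f x)]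
  refine tsum_congr fun x => ?_
  change E (fun i => e i * x (τ i)) * f (fun i => e i * x (τ i)) = _
  rw [hE τ e he x]

lemma tsum_eq_zero_of_odd {E : (Fin d → ℤ) → ℝ} (hE : ZdSymm E) (e : Fin d → ℤ)
    (he : ∀ i, e i = 1 ∨ e i = -1) (f : (Fin d → ℤ) → ℝ)
    (hf : ∀ x, f (fun i => e i * x i) = -f x) : ∑' x, E x * f x = 0 := by
  have h := tsum_comp_signedPerm hE 1 e he f
  simp only [Equiv.Perm.one_apply, hf, mul_neg, tsum_neg] at h
  linarith

lemma monomialList_neg (l : List (Fin d)) (x : Fin d → ℤ) :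
    monomialList l (fun i => (-1) * x i) = (-1) ^ l.length * monomialList l x := by
  induction l with
  | nil => simp
  | cons i l ih =>
    rw [monomialList_cons, ih, monomialList_cons, List.length_cons, pow_succ]
    push_cast
    ring

/-- Second moments of a symmetric function vanish coordinatewise when the total one does. -/
lemma tsum_mul_sq_eq_zero {E : (Fin d → ℤ) → ℝ} (hE : ZdSymm E) {N : ℕ}
    (hS : Summable fun x => |E x| * nn x ^ N) (hN : 2 ≤ N)
    (h2 : ∑' x : Fin d → ℤ, znorm x ^ 2 * E x = 0) (i : Fin d) :
    ∑' x : Fin d → ℤ, E x * monomialList [i, i] x = 0 := by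
  have hj (j : Fin d) : ∑' x : Fin d → ℤ, E x * monomialList [j, j] x =
      ∑' x : Fin d → ℤ, E x * monomialList [i, i] x := by
    rw [tsum_comp_signedPerm hE (Equiv.swap i j) (fun _ => 1) (fun _ => Or.inl rfl)]
    simp
  have hz : ∑' x : Fin d → ℤ, znorm x ^ 2 * E x =
      ∑ j, ∑' x : Fin d → ℤ, E x * monomialList [j, j] x := by
    rw [← Summable.tsum_finsetSum fun j _ => summable_mul_monomialList hS [j, j] hN]
    refine tsum_congr fun x => ?_
    rw [znorm, Real.sq_sqrt (Finset.sum_nonneg fun _ _ => sq_nonneg _), Finset.sum_mul]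
    exact Finset.sum_congr rfl fun j _ => by simp; ring
  rw [hz, Finset.sum_congr rfl fun j _ => hj j, Finset.sum_const, Finset.card_univ,
    Fintype.card_fin, nsmul_eq_mul] at h2
  have : (d : ℝ) ≠ 0 := by exact_mod_cast (Fin.pos i).ne'
  exact (mul_eq_zero.1 h2).resolve_left this

/-- All moments of order at most three vanish. -/
lemma tsum_mul_monomialList_eq_zero {E : (Fin d → ℤ) → ℝ} (hE : ZdSymm E) {N : ℕ} (hN3 : N ≤ 3)
    (hS : Summable fun x => |E x| * nn x ^ N) (h0 : ∑' x : Fin d → ℤ, E x = 0)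
    (h2 : ∑' x : Fin d → ℤ, znorm x ^ 2 * E x = 0) (l : List (Fin d)) (hl : l.length ≤ N) :
    ∑' x : Fin d → ℤ, E x * monomialList l x = 0 := by
  have hodd (h : Odd l.length) : ∑' x : Fin d → ℤ, E x * monomialList l x = 0 :=
    tsum_eq_zero_of_odd hE (fun _ => -1) (fun _ => Or.inr rfl) _ fun x => by
      rw [monomialList_neg, h.neg_one_pow, neg_one_mul]
  match l, hl, hodd with
  | [], _, _ => simpa using h0
  | [i], _, hodd => exact hodd (by simp)
  | [i, j], hl, _ =>
    by_cases hij : i = j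
    · subst hij
      exact tsum_mul_sq_eq_zero hE hS hl h2 i
    · refine tsum_eq_zero_of_odd hE (fun m => if m = i then -1 else 1)
        (fun m => by by_cases h : m = i <;> simp [h]) _ fun x => ?_
      simp [Ne.symm hij]
  | [i, j, m], _, hodd => exact hodd (by simp [Nat.odd_iff])
  | _ :: _ :: _ :: _ :: _, hl, _ =>
    simp only [List.length_cons] at hl
    lia

lemma summable_mul_monomialList_mul_pow {E : (Fin d → ℤ) → ℝ} {N : ℕ}
    (hS : Summable fun x => |E x| * nn x ^ N) (k : Fin d → ℝ) (j : ℕ) (l : List (Fin d))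
    (hl : l.length + j ≤ N) :
    Summable fun x : Fin d → ℤ => E x * monomialList l x * (∑ i, k i * (x i : ℝ)) ^ j := by
  refine Summable.of_norm_bounded (hS.mul_left (rnorm k ^ j)) fun x => ?_
  rw [Real.norm_eq_abs, abs_mul, abs_mul, abs_pow]
  calc |E x| * |monomialList l x| * |∑ i, k i * (x i : ℝ)| ^ j
      ≤ |E x| * nn x ^ l.length * (rnorm k * nn x) ^ j := by
        have := (nn_pos x).le
        gcongr
        · exact abs_monomialList_le l x
        · exact abs_sum_mul_le k x
    _ = rnorm k ^ j * (|E x| * nn x ^ (l.length + j)) := by rw [mul_pow, pow_add]; ring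
    _ ≤ rnorm k ^ j * (|E x| * nn x ^ N) := by
        have : 0 ≤ rnorm k := Real.sqrt_nonneg _
        gcongr
        exact one_le_nn x

lemma tsum_mul_monomialList_mul_pow_eq_zero {E : (Fin d → ℤ) → ℝ} {N : ℕ}
    (hS : Summable fun x => |E x| * nn x ^ N)
    (hM : ∀ l : List (Fin d), l.length ≤ N → ∑' x : Fin d → ℤ, E x * monomialList l x = 0)
    (k : Fin d → ℝ) (j : ℕ) (l : List (Fin d)) (hl : l.length + j ≤ N) :
    ∑' x : Fin d → ℤ, E x * monomialList l x * (∑ i, k i * (x i : ℝ)) ^ j = 0 := by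
  induction j generalizing l with
  | zero => simpa using hM l hl
  | succ j ih =>
    have hl' (i : Fin d) : (i :: l).length + j ≤ N := by rw [List.length_cons]; lia
    have h (x : Fin d → ℤ) : E x * monomialList l x * (∑ i, k i * (x i : ℝ)) ^ (j + 1) =
        ∑ i, k i * (E x * monomialList (i :: l) x * (∑ i, k i * (x i : ℝ)) ^ j) := by
      rw [pow_succ', Finset.sum_mul, Finset.mul_sum]
      exact Finset.sum_congr rfl fun i _ => by rw [monomialList_cons]; ring
    simp_rw [h]
    rw [Summable.tsum_finsetSum fun i _ =>
      (summable_mul_monomialList_mul_pow hS k j (i :: l) (hl' i)).mul_left _]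
    refine Finset.sum_eq_zero fun i _ => ?_
    rw [tsum_mul_left, ih _ (hl' i), mul_zero]

/-- Interpolated Taylor remainder bound for `e^{it}`. -/
lemma norm_exp_sub_taylor_le (t : ℝ) (J : ℕ) {θ : ℝ} (h1 : (J : ℝ) ≤ θ) (h2 : θ ≤ J + 1)
    (hθ : 0 < θ) :
    ‖Complex.exp (Complex.I * t) -
        ∑ j ∈ Finset.range (J + 1), (Complex.I * t) ^ j / j.factorial‖ ≤ (J + 3) * |t| ^ θ := by
  have hn : ‖Complex.I * (t : ℂ)‖ = |t| := by simp
  rcases le_total |t| 1 with ht | ht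
  · rcases eq_or_ne t 0 with rfl | h0
    · simp [Finset.sum_range_succ', Real.zero_rpow hθ.ne']
    have hpos : 0 < |t| := abs_pos.2 h0
    have h := Complex.norm_exp_sub_sum_le_norm_mul_exp (Complex.I * t) (J + 1)
    rw [hn] at h
    have h3 : |t| ^ (J + 1) ≤ |t| ^ θ := by
      rw [← Real.rpow_natCast]
      exact Real.rpow_le_rpow_of_exponent_ge hpos ht (by push_cast; exact h2)
    have h4 : Real.exp |t| ≤ J + 3 := by
      have := Real.exp_le_exp.2 ht
      have := Real.exp_one_lt_d9
      have : (0 : ℝ) ≤ J := Nat.cast_nonneg _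
      linarith
    calc _ ≤ _ := h
      _ ≤ |t| ^ θ * (J + 3) := by gcongr
      _ = _ := mul_comm _ _
  · have h5 (j : ℕ) (hj : j ≤ J) : |t| ^ j ≤ |t| ^ θ := by
      rw [← Real.rpow_natCast]
      exact Real.rpow_le_rpow_of_exponent_le ht (le_trans (by exact_mod_cast hj) h1)
    have h6 : ‖∑ j ∈ Finset.range (J + 1), (Complex.I * (t : ℂ)) ^ j / j.factorial‖ ≤
        (J + 1) * |t| ^ θ := by
      refine (norm_sum_le_of_le _ (f := fun j : ℕ => (Complex.I * (t : ℂ)) ^ j / j.factorial)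
        (n := fun _ => |t| ^ θ) fun j hj => ?_).trans ?_
      · rw [norm_div, norm_pow, hn, Complex.norm_natCast]
        exact (div_le_self (by positivity) (by exact_mod_cast j.factorial_pos)).trans
          (h5 j (Nat.lt_succ_iff.1 (Finset.mem_range.1 hj)))
      · simp
    have h7 : ‖Complex.exp (Complex.I * t)‖ ≤ |t| ^ θ := by
      rw [mul_comm, Complex.norm_exp_ofReal_mul_I]
      simpa using h5 0 (Nat.zero_le _)
    have h8 : 0 ≤ |t| ^ θ := by positivity
    calc _ ≤ _ := norm_sub_le _ _
      _ ≤ |t| ^ θ + (J + 1) * |t| ^ θ := add_le_add h7 h6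
      _ ≤ _ := by linarith

lemma abs_mul_nn_rpow_le {E : (Fin d → ℤ) → ℝ} {K ρ : ℝ}
    (hE : ∀ x : Fin d → ℤ, |E x| ≤ K * nn x ^ (-((d : ℝ) + 2 + ρ))) (s : ℝ) (x : Fin d → ℤ) :
    |E x| * nn x ^ s ≤ K * nn x ^ (-((d : ℝ) + (2 + ρ - s))) := by
  refine (mul_le_mul_of_nonneg_right (hE x) (Real.rpow_nonneg (nn_pos x).le _)).trans_eq ?_
  rw [mul_assoc, ← Real.rpow_add (nn_pos x)]
  ring_nf

lemma summable_abs_mul_nn_rpow {E : (Fin d → ℤ) → ℝ} {K ρ : ℝ}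
    (hE : ∀ x : Fin d → ℤ, |E x| ≤ K * nn x ^ (-((d : ℝ) + 2 + ρ))) {s : ℝ} (hs : s < 2 + ρ) :
    Summable fun x => |E x| * nn x ^ s := by
  refine Summable.of_nonneg_of_le
    (fun x => mul_nonneg (abs_nonneg _) (Real.rpow_nonneg (nn_pos x).le _))
    (abs_mul_nn_rpow_le hE s) ((summable_nn_rpow ?_).mul_left K)
  linarith

/-- Subtracting the Taylor polynomial of the exponential, which does not contribute when the
moments vanish, bounds the differentiated series. -/
lemma norm_foldr_pd_ft_le {E : (Fin d → ℤ) → ℝ} {l : List (Fin d)} {J : ℕ} {θ : ℝ}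
    (h1 : (J : ℝ) ≤ θ) (h2 : θ ≤ J + 1) (hθ : 0 < θ)
    (hS : Summable fun x => |E x| * nn x ^ (l.length + J))
    (hT : Summable fun x => |E x| * nn x ^ (l.length + θ))
    (hM : ∀ l' : List (Fin d), l'.length ≤ l.length + J →
      ∑' x : Fin d → ℤ, E x * monomialList l' x = 0) (k : Fin d → ℝ) :
    ‖l.foldr (fun i g => pd i g) (ft E) k‖ ≤
      (J + 3) * (∑' x, |E x| * nn x ^ (l.length + θ)) * rnorm k ^ θ := by
  rw [foldr_pd_ft hS l (Nat.le_add_right _ _)]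
  set m := l.length
  let P : (Fin d → ℤ) → ℂ := fun x => ∑ j ∈ Finset.range (J + 1),
    (Complex.I * ((∑ i, k i * (x i : ℝ) : ℝ) : ℂ)) ^ j / j.factorial
  have hterm (j : ℕ) (x : Fin d → ℤ) : ((E x * monomialList l x : ℝ) * Complex.I ^ m : ℂ) *
      ((Complex.I * ((∑ i, k i * (x i : ℝ) : ℝ) : ℂ)) ^ j / j.factorial) =
      (Complex.I ^ m * Complex.I ^ j / j.factorial) *
        ((E x * monomialList l x * (∑ i, k i * (x i : ℝ)) ^ j : ℝ) : ℂ) := by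
    push_cast
    ring
  have hjm {j : ℕ} (hj : j ∈ Finset.range (J + 1)) : l.length + j ≤ l.length + J := by
    have := Finset.mem_range.1 hj
    lia
  have hsj (j : ℕ) (hj : j ∈ Finset.range (J + 1)) : Summable fun x : Fin d → ℤ =>
      ((E x * monomialList l x : ℝ) * Complex.I ^ m : ℂ) *
      ((Complex.I * ((∑ i, k i * (x i : ℝ) : ℝ) : ℂ)) ^ j / j.factorial) := by
    simp_rw [hterm]
    exact (Complex.summable_ofReal.2
      (summable_mul_monomialList_mul_pow hS k j l (hjm hj))).mul_left _
  have hsP : Summable fun x => ((E x * monomialList l x : ℝ) * Complex.I ^ m : ℂ) * P x := by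
    simp only [P, Finset.mul_sum]
    exact summable_sum hsj
  have hP : ∑' x, ((E x * monomialList l x : ℝ) * Complex.I ^ m : ℂ) * P x = 0 := by
    simp only [P, Finset.mul_sum]
    rw [Summable.tsum_finsetSum hsj]
    refine Finset.sum_eq_zero fun j hj => ?_
    simp_rw [hterm]
    rw [tsum_mul_left, ← Complex.ofReal_tsum,
      tsum_mul_monomialList_mul_pow_eq_zero hS hM k j l (hjm hj), Complex.ofReal_zero, mul_zero]
  have hse : Summable fun x : Fin d → ℤ => ((E x * monomialList l x : ℝ) * Complex.I ^ m : ℂ) *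
      Complex.exp (Complex.I * ((∑ i, k i * (x i : ℝ) : ℝ) : ℂ)) := by
    refine Summable.of_norm_bounded
      (summable_mul_monomialList hS l (Nat.le_add_right _ _)).norm fun x => ?_
    rw [norm_mul, norm_mul, norm_pow, Complex.norm_I, one_pow, mul_one, mul_comm Complex.I,
      Complex.norm_exp_ofReal_mul_I, mul_one, Complex.norm_real]
  have hr : 0 ≤ rnorm k := Real.sqrt_nonneg _
  change ‖∑' x : Fin d → ℤ, _‖ ≤ _
  rw [← sub_zero (∑' x : Fin d → ℤ, _), ← hP, ← hse.tsum_sub hsP]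
  refine (tsum_of_norm_bounded ((hT.mul_left ((J + 3) * rnorm k ^ θ)).hasSum) fun x => ?_).trans_eq
    (by rw [tsum_mul_left]; ring)
  rw [← mul_sub, norm_mul, norm_mul, norm_pow, Complex.norm_I, one_pow, mul_one, Complex.norm_real,
    Real.norm_eq_abs, abs_mul]
  have hx := nn_pos x
  calc |E x| * |monomialList l x| * ‖_‖
      ≤ |E x| * nn x ^ m * ((J + 3) * (rnorm k * nn x) ^ θ) := by
        gcongr
        · exact abs_monomialList_le l x
        · refine (norm_exp_sub_taylor_le _ J h1 h2 hθ).trans ?_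
          gcongr
          exact abs_sum_mul_le k x
    _ = (J + 3) * rnorm k ^ θ * (|E x| * nn x ^ (m + θ)) := by
        rw [Real.mul_rpow hr hx.le, Real.rpow_add hx, Real.rpow_natCast]
        ring

end SO

/-- Lemma 2.6 = Lemma 2.2 of LS24a: if `E` is ℤ^d-symmetric with
vanishing zeroth and second moments and `|E(x)| ≤ K⟨x⟩^{−(d+2+ρ)}`, then
`|Ê_α(k)| ≤ cK|k|^{2+σ−|α|}` for `σ ∈ (0,ρ)`, `σ ≤ 2`, `|α| < 2+σ`. -/
theorem Ehat_derivative_bound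
    (d : ℕ) (hd : 1 ≤ d) (ρ : ℝ) (hρ : 0 < ρ)
    (σ : ℝ) (hσ0 : 0 < σ) (hσρ : σ < ρ) (hσ2 : σ ≤ 2) :
    ∃ c : ℝ, 0 < c ∧
      ∀ α : Fin d → ℕ, (SO.deg α : ℝ) < 2 + σ →
      ∀ (E : (Fin d → ℤ) → ℝ) (K : ℝ), 0 < K →
        SO.ZdSymm E →
        (∑' x : Fin d → ℤ, E x) = 0 →
        (∑' x : Fin d → ℤ, SO.znorm x ^ 2 * E x) = 0 →
        (∀ x : Fin d → ℤ, |E x| ≤ K * SO.nn x ^ (-((d : ℝ) + 2 + ρ))) →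
        ∀ k ∈ SO.Td d,
          ‖SO.mderiv α (SO.ft E) k‖ ≤ c * K * SO.rnorm k ^ (2 + σ - (SO.deg α : ℝ)) := by
  have hδ : -((d : ℝ) + (ρ - σ)) < -(d : ℝ) := by linarith
  have hZ := SO.summable_nn_rpow hδ
  have hZ0 : 0 ≤ ∑' x : Fin d → ℤ, SO.nn x ^ (-((d : ℝ) + (ρ - σ))) :=
    tsum_nonneg fun x => Real.rpow_nonneg (SO.nn_pos x).le _
  refine ⟨6 * (∑' x : Fin d → ℤ, SO.nn x ^ (-((d : ℝ) + (ρ - σ))) + 1), by positivity, ?_⟩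
  intro α hα E K hK hsymm h0 h2 hE k _
  obtain ⟨N, hN3, hNρ, hNσ, hσN, hmN⟩ : ∃ N : ℕ, N ≤ 3 ∧ (N : ℝ) < 2 + ρ ∧ (N : ℝ) ≤ 2 + σ ∧
      2 + σ ≤ N + 1 ∧ SO.deg α ≤ N := by
    rcases le_or_gt σ 1 with h | h
    · refine ⟨2, by norm_num, by push_cast; linarith, by push_cast; linarith,
        by push_cast; linarith, ?_⟩
      have : (SO.deg α : ℝ) < 3 := by linarith
      exact Nat.lt_succ_iff.1 (by exact_mod_cast this)
    · refine ⟨3, le_rfl, by push_cast; linarith, by push_cast; linarith,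
        by push_cast; linarith, ?_⟩
      have : (SO.deg α : ℝ) < 4 := by linarith
      exact Nat.lt_succ_iff.1 (by exact_mod_cast this)
  obtain ⟨J, rfl⟩ := Nat.exists_eq_add_of_le hmN
  push_cast at hNρ hNσ hσN
  have hlen := SO.length_flatMap_replicate α
  have hexp : (SO.deg α : ℝ) + (2 + σ - SO.deg α) = 2 + σ := by ring
  have hS : Summable fun x => |E x| * SO.nn x ^ (SO.deg α + J) := by
    have := SO.summable_abs_mul_nn_rpow hE hNρ
    exact_mod_cast this
  have hT : Summable fun x => |E x| * SO.nn x ^ (2 + σ) :=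
    SO.summable_abs_mul_nn_rpow hE (by linarith)
  have hmain := SO.norm_foldr_pd_ft_le (E := E)
    (l := (List.finRange d).flatMap fun i => List.replicate (α i) i) (J := J)
    (θ := 2 + σ - SO.deg α) (by linarith) (by linarith) (by linarith)
    (by rwa [hlen]) (by rwa [hlen, hexp])
    (by
      rw [hlen]
      exact fun l' => SO.tsum_mul_monomialList_eq_zero hsymm hN3 hS h0 h2 l') k
  rw [hlen, hexp] at hmain
  have hsum : ∑' x, |E x| * SO.nn x ^ (2 + σ) ≤
      K * ∑' x : Fin d → ℤ, SO.nn x ^ (-((d : ℝ) + (ρ - σ))) := by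
    rw [← tsum_mul_left]
    refine hT.tsum_le_tsum (fun x => ?_) (hZ.mul_left K)
    refine (SO.abs_mul_nn_rpow_le hE (2 + σ) x).trans_eq ?_
    ring_nf
  have hJ : (J : ℝ) + 3 ≤ 6 := by
    have : J ≤ 3 := (Nat.le_add_left _ _).trans hN3
    have : (J : ℝ) ≤ 3 := by exact_mod_cast this
    linarith
  refine hmain.trans (mul_le_mul_of_nonneg_right ?_ (Real.rpow_nonneg (Real.sqrt_nonneg _) _))
  calc ((J : ℝ) + 3) * ∑' x, |E x| * SO.nn x ^ (2 + σ)
      ≤ 6 * (K * ∑' x : Fin d → ℤ, SO.nn x ^ (-((d : ℝ) + (ρ - σ)))) :=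
        mul_le_mul hJ hsum (tsum_nonneg fun x =>
          mul_nonneg (abs_nonneg _) (Real.rpow_nonneg (SO.nn_pos x).le _)) (by norm_num)
    _ ≤ _ := by linarith
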